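/- Let α > 1/2 and δ ∈ (−1, 0) be fixed, and set A(n) = √(4(1+δ)α (log n)/n). Then lim_{n→∞} (log(1 − R_n(A(n)))) / (log n) = 1/2 − α. Moreover, there exist absolute constants c, C ∈ (0, ∞) and a threshold n₀(α, δ) < ∞ such that for all n ≥ n₀(α, δ): c ≤ (1 − R_n(A(n))) / (√((1+δ)α) · n^{1/2−α} · √(log n)) ≤ C. -/

import Mathlib

open MeasureTheory ProbabilityTheory Real Filter Topology

noncomputable section

/-- Law of the N×N Gaussian observation matrix with mean matrix θ and unit variances. -/
def PTheta (N : ℕ) (θ : Fin N → Fin N → ℝ) : Measure (Fin N → Fin N → ℝ) :=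
  Measure.pi fun i => Measure.pi fun j => gaussianReal (θ i j) 1

/-- Parameter space Θ(A, n, N). -/
def ThetaSet (A : ℝ) (n N : ℕ) : Set (Fin N → Fin N → ℝ) :=
  {θ | ∃ R C : Finset (Fin N), R.card = n ∧ C.card = n ∧
    (∀ i j, i ∈ R → j ∈ C → A ≤ θ i j) ∧
    (∀ i j, ¬(i ∈ R ∧ j ∈ C) → θ i j = 0)}

/-- Risk of the test with rejection region `T`: type-I error plus worst-case type-II error. -/
def testRisk (n N : ℕ) (A : ℝ) (T : Set (Fin N → Fin N → ℝ)) : ℝ :=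
  (PTheta N 0 T).toReal + ⨆ θ : ThetaSet A n N, (PTheta N θ.1 Tᶜ).toReal

/-- Minimax risk over all (measurable) tests. -/
def minimaxRisk (n N : ℕ) (A : ℝ) : ℝ :=
  ⨅ T : {T : Set (Fin N → Fin N → ℝ) // MeasurableSet T}, testRisk n N A T.1

/-! ### Gaussian densities -/

/-- Euclidean inner product of matrices. -/
def ipm {N : ℕ} (v x : Fin N → Fin N → ℝ) : ℝ := ∑ i, ∑ j, v i j * x i j

lemma pi_withDensity_aux {ι : Type*} [Fintype ι] {E : ι → Type*} [∀ i, MeasurableSpace (E i)]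
    (μ ν : ∀ i, Measure (E i)) [∀ i, IsProbabilityMeasure (μ i)] [∀ i, IsProbabilityMeasure (ν i)]
    (f : ∀ i, E i → ENNReal) (hf : ∀ i, Measurable (f i))
    (h : ∀ i, ν i = (μ i).withDensity (f i)) :
    Measure.pi ν = (Measure.pi μ).withDensity (fun x => ∏ i, f i (x i)) := by
  symm
  refine (Measure.pi_eq (fun s hs => ?_)).symm
  rw [withDensity_apply _ (MeasurableSet.univ_pi hs), ← lintegral_indicator (MeasurableSet.univ_pi hs)]
  have h1 : (Set.univ.pi s).indicator (fun x => ∏ i, f i (x i))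
      = fun x => ∏ i, (s i).indicator (f i) (x i) := by
    funext x
    by_cases hx : x ∈ Set.univ.pi s
    · rw [Set.indicator_of_mem hx]
      refine Finset.prod_congr rfl fun i _ => ?_
      rw [Set.indicator_of_mem (hx i (Set.mem_univ i))]
    · rw [Set.indicator_of_notMem hx]
      simp only [Set.mem_pi, Set.mem_univ, true_implies, not_forall] at hx
      obtain ⟨i, hi⟩ := hx
      symm
      exact Finset.prod_eq_zero (Finset.mem_univ i) (Set.indicator_of_notMem hi _)
  rw [h1]
  have hm : ∀ i, Measurable ((s i).indicator (f i)) := fun i => (hf i).indicator (hs i)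
  rw [lintegral_prod_eq_prod_lintegral_of_indepFun Finset.univ
    (fun i (x : ∀ i, E i) => (s i).indicator (f i) (x i))
    (iIndepFun_pi (fun i => (hm i).aemeasurable))
    (fun i => (hm i).comp (measurable_pi_apply i))]
  refine Finset.prod_congr rfl fun i _ => ?_
  rw [h i, withDensity_apply _ (hs i), ← lintegral_indicator (hs i)]
  exact (measurePreserving_eval μ i).lintegral_comp (hm i)

lemma gaussian_density (m : ℝ) :
    gaussianReal m 1 = (gaussianReal 0 1).withDensity
      (fun x => ENNReal.ofReal (rexp (m * x - m * m / 2))) := by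
  rw [gaussianReal_of_var_ne_zero m one_ne_zero, gaussianReal_of_var_ne_zero 0 one_ne_zero,
    ← withDensity_mul _ (measurable_gaussianPDF 0 1) (by fun_prop)]
  congr 1
  funext x
  simp only [Pi.mul_apply, gaussianPDF, gaussianPDFReal]
  rw [← ENNReal.ofReal_mul (by positivity)]
  congr 1
  rw [mul_assoc (√_)⁻¹ (rexp _) (rexp _), ← Real.exp_add]
  congr 2
  push_cast
  ring

instance (N : ℕ) (θ : Fin N → Fin N → ℝ) : IsProbabilityMeasure (PTheta N θ) := by
  unfold PTheta; infer_instance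

lemma PTheta_density (N : ℕ) (θ : Fin N → Fin N → ℝ) :
    PTheta N θ = (PTheta N 0).withDensity
      (fun x => ENNReal.ofReal (rexp (ipm θ x - ipm θ θ / 2))) := by
  unfold PTheta
  rw [pi_withDensity_aux (fun i => Measure.pi fun j => gaussianReal ((0 : Fin N → Fin N → ℝ) i j) 1)
    (fun i => Measure.pi fun j => gaussianReal (θ i j) 1)
    (fun i x => ∏ j, ENNReal.ofReal (rexp (θ i j * x j - θ i j * θ i j / 2)))
    (fun i => by fun_prop) (fun i => ?_)]
  · congr 1
    funext x
    simp_rw [← ENNReal.ofReal_prod_of_nonneg (fun _ _ => (Real.exp_pos _).le)]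
    rw [← ENNReal.ofReal_prod_of_nonneg (fun _ _ => Finset.prod_nonneg fun _ _ => (Real.exp_pos _).le)]
    simp_rw [← Real.exp_sum]
    congr 2
    simp only [ipm, Finset.sum_div, Finset.sum_sub_distrib]
  · exact pi_withDensity_aux (fun j => gaussianReal ((0 : Fin N → Fin N → ℝ) i j) 1)
      (fun j => gaussianReal (θ i j) 1)
      (fun j x => ENNReal.ofReal (rexp (θ i j * x - θ i j * θ i j / 2)))
      (fun j => by fun_prop) (fun j => gaussian_density _)

@[fun_prop]
lemma measurable_ipm {N : ℕ} (v : Fin N → Fin N → ℝ) : Measurable (ipm v) := by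
  unfold ipm; fun_prop

lemma ipm_comm {N : ℕ} (v w : Fin N → Fin N → ℝ) : ipm v w = ipm w v := by
  simp [ipm, mul_comm]
lemma ipm_add_left {N : ℕ} (u v w : Fin N → Fin N → ℝ) : ipm (u + v) w = ipm u w + ipm v w := by
  simp [ipm, add_mul, Finset.sum_add_distrib]
lemma ipm_add_right {N : ℕ} (u v w : Fin N → Fin N → ℝ) : ipm w (u + v) = ipm w u + ipm w v := by
  simp [ipm, mul_add, Finset.sum_add_distrib]
lemma ipm_smul_left {N : ℕ} (c : ℝ) (v w : Fin N → Fin N → ℝ) : ipm (c • v) w = c * ipm v w := by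
  simp [ipm, mul_assoc, Finset.mul_sum]
lemma ipm_smul_right {N : ℕ} (c : ℝ) (v w : Fin N → Fin N → ℝ) : ipm w (c • v) = c * ipm w v := by
  rw [ipm_comm, ipm_smul_left, ipm_comm]

lemma lintegral_exp_ipm (N : ℕ) (v : Fin N → Fin N → ℝ) :
    ∫⁻ x, ENNReal.ofReal (rexp (ipm v x - ipm v v / 2)) ∂(PTheta N 0) = 1 := by
  have h : PTheta N v Set.univ = 1 := measure_univ
  rw [PTheta_density, withDensity_apply _ MeasurableSet.univ, Measure.restrict_univ] at h
  exact h

lemma integrable_exp_ipm' (N : ℕ) (v : Fin N → Fin N → ℝ) :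
    Integrable (fun x => rexp (ipm v x - ipm v v / 2)) (PTheta N 0) := by
  refine ⟨by fun_prop, ?_⟩
  rw [hasFiniteIntegral_iff_ofReal (Filter.Eventually.of_forall fun x => (Real.exp_pos _).le),
    lintegral_exp_ipm]
  exact ENNReal.one_lt_top

lemma integral_exp_ipm' (N : ℕ) (v : Fin N → Fin N → ℝ) :
    ∫ x, rexp (ipm v x - ipm v v / 2) ∂(PTheta N 0) = 1 := by
  rw [integral_eq_lintegral_of_nonneg_ae (Filter.Eventually.of_forall fun x => (Real.exp_pos _).le)
    (by fun_prop), lintegral_exp_ipm]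
  simp

lemma integrable_exp_ipm (N : ℕ) (v : Fin N → Fin N → ℝ) (c : ℝ) :
    Integrable (fun x => rexp (ipm v x + c)) (PTheta N 0) := by
  have := (integrable_exp_ipm' N v).const_mul (rexp (c + ipm v v / 2))
  refine this.congr (Filter.Eventually.of_forall fun x => ?_)
  simp only [← Real.exp_add]
  congr 1; ring

lemma integral_exp_ipm (N : ℕ) (v : Fin N → Fin N → ℝ) (c : ℝ) :
    ∫ x, rexp (ipm v x + c) ∂(PTheta N 0) = rexp (ipm v v / 2 + c) := by
  have : (fun x => rexp (ipm v x + c)) =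
      fun x => rexp (c + ipm v v / 2) * rexp (ipm v x - ipm v v / 2) := by
    funext x
    rw [← Real.exp_add]
    congr 1; ring
  rw [this, integral_const_mul, integral_exp_ipm', mul_one, add_comm]

/-- likelihood ratio -/
def LR {N : ℕ} (θ x : Fin N → Fin N → ℝ) : ℝ := rexp (ipm θ x - ipm θ θ / 2)

lemma PTheta_apply (N : ℕ) (θ : Fin N → Fin N → ℝ) {T : Set (Fin N → Fin N → ℝ)}
    (hT : MeasurableSet T) :
    (PTheta N θ T).toReal = ∫ x in T, LR θ x ∂(PTheta N 0) := by
  rw [PTheta_density, withDensity_apply _ hT]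
  unfold LR
  rw [integral_eq_lintegral_of_nonneg_ae (Filter.Eventually.of_forall fun x => (Real.exp_pos _).le)
    (by fun_prop)]

/-- Law of a linear functional. -/
lemma integral_PTheta_exp (N : ℕ) (θ v : Fin N → Fin N → ℝ) :
    ∫ x, rexp (ipm v x) ∂(PTheta N θ) = rexp (ipm v θ + ipm v v / 2) := by
  rw [PTheta_density, integral_withDensity_eq_integral_toReal_smul (by fun_prop) (by simp)]
  have : ∀ x, (ENNReal.ofReal (rexp (ipm θ x - ipm θ θ / 2))).toReal • rexp (ipm v x)
      = rexp (ipm (θ + v) x + (- ipm θ θ / 2)) := by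
    intro x
    rw [ENNReal.toReal_ofReal (Real.exp_pos _).le, smul_eq_mul, ← Real.exp_add, ipm_add_left]
    congr 1; ring
  simp_rw [this]
  rw [integral_exp_ipm]
  congr 1
  simp only [ipm_add_left, ipm_add_right, ipm_comm θ v]
  ring

lemma law_ipm (N : ℕ) (θ v : Fin N → Fin N → ℝ) (s : NNReal) (hs : ipm v v = s) :
    (PTheta N θ).map (ipm v) = gaussianReal (ipm v θ) s := by
  have hmgf : mgf (ipm v) (PTheta N θ) = mgf id (gaussianReal (ipm v θ) s) := by
    rw [mgf_id_gaussianReal]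
    funext t
    have := integral_PTheta_exp N θ (t • v)
    simp only [ipm_smul_left, ipm_smul_right, hs] at this
    rw [mgf, this]
    congr 1; ring
  have hset : integrableExpSet (ipm v) (PTheta N θ) = Set.univ := by
    rw [integrableExpSet_eq_of_mgf hmgf, integrableExpSet_id_gaussianReal]
  have h := eqOn_complexMGF_of_mgf hmgf
  rw [hset] at h
  have := Measure.ext_of_complexMGF_eq (X := ipm v) (Y := id) (μ := PTheta N θ)
    (μ' := gaussianReal (ipm v θ) s) (by fun_prop) (by fun_prop) (funext fun z => h (by simp))
  simpa using this

/-! ### The linear test -/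

lemma gaussian_Iio_le {m μ : ℝ} (h : μ ≤ m) :
    (gaussianReal m 1 (Set.Iio 0)) ≤ gaussianReal 0 1 (Set.Iio (-μ)) := by
  have h1 : gaussianReal m 1 = (gaussianReal 0 1).map (· + m) := by
    rw [gaussianReal_map_add_const]; simp
  rw [h1, Measure.map_apply (by fun_prop) measurableSet_Iio]
  refine measure_mono fun x hx => ?_
  simp only [Set.mem_preimage, Set.mem_Iio] at hx ⊢
  linarith

lemma gaussian_Ico_ge {μ : ℝ} (h0 : 0 ≤ μ) (h1 : μ ≤ 1) :
    μ * gaussianPDFReal 0 1 1 ≤ (gaussianReal 0 1 (Set.Ico (-μ) 0)).toReal := by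
  rw [gaussianReal_apply_eq_integral 0 one_ne_zero, ENNReal.toReal_ofReal
    (integral_nonneg fun x => gaussianPDFReal_nonneg _ _ _)]
  have hc : ∫ x in Set.Ico (-μ) 0, gaussianPDFReal 0 1 1 = μ * gaussianPDFReal 0 1 1 := by
    simp [h0]
  rw [← hc]
  refine setIntegral_mono_on (by simp) (integrable_gaussianPDFReal 0 1).integrableOn
    measurableSet_Ico fun x hx => ?_
  simp only [gaussianPDFReal]
  refine mul_le_mul_of_nonneg_left (Real.exp_le_exp.2 ?_) (by positivity)
  have : x ^ 2 ≤ 1 := by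
    have := hx.1; have := hx.2; nlinarith
  simp only [NNReal.coe_one]
  linarith

lemma testRisk_nonneg (n N : ℕ) (A : ℝ) (T : Set (Fin N → Fin N → ℝ)) : 0 ≤ testRisk n N A T := by
  unfold testRisk
  have : 0 ≤ ⨆ θ : ThetaSet A n N, (PTheta N θ.1 Tᶜ).toReal :=
    Real.iSup_nonneg fun _ => ENNReal.toReal_nonneg
  positivity

lemma minimaxRisk_le_testRisk (n N : ℕ) (A : ℝ) (T : Set (Fin N → Fin N → ℝ))
    (hT : MeasurableSet T) : minimaxRisk n N A ≤ testRisk n N A T :=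
  ciInf_le (f := fun T : {T : Set (Fin N → Fin N → ℝ) // MeasurableSet T} => testRisk n N A T.1)
    ⟨0, by rintro _ ⟨T, rfl⟩; exact testRisk_nonneg _ _ _ _⟩ ⟨T, hT⟩

lemma minimaxRisk_upper (n N : ℕ) (A μ : ℝ) (hN : 0 < N) (hA : 0 ≤ A) (h0 : 0 ≤ μ) (h1 : μ ≤ 1)
    (hμ : μ ≤ (n : ℝ) ^ 2 * A / N) :
    minimaxRisk n N A ≤ 1 - μ * gaussianPDFReal 0 1 1 := by
  have hN' : (0 : ℝ) < N := by exact_mod_cast hN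
  let v : Fin N → Fin N → ℝ := fun _ _ => 1 / (N : ℝ)
  have hvv : ipm v v = (1 : NNReal) := by
    simp [ipm, v]
    field_simp
  have hm : MeasurableSet {x | 0 ≤ ipm v x} := measurableSet_le measurable_const (by fun_prop)
  refine (minimaxRisk_le_testRisk n N A {x | 0 ≤ ipm v x} hm).trans ?_
  have e0 : PTheta N 0 {x | 0 ≤ ipm v x} = gaussianReal 0 1 (Set.Ici 0) := by
    have := law_ipm N 0 v 1 hvv
    have h2 : ipm v 0 = 0 := by simp [ipm]
    rw [h2] at this
    rw [← this, Measure.map_apply (by fun_prop) measurableSet_Ici]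
    rfl
  have e1 : ∀ θ : ThetaSet A n N, (PTheta N θ.1 {x | 0 ≤ ipm v x}ᶜ).toReal
      ≤ (gaussianReal 0 1 (Set.Iio (-μ))).toReal := by
    rintro ⟨θ, R, C, hR, hC, hθ, hθ0⟩
    have h3 : PTheta N θ {x | 0 ≤ ipm v x}ᶜ = gaussianReal (ipm v θ) 1 (Set.Iio 0) := by
      rw [← law_ipm N θ v 1 hvv, Measure.map_apply (by fun_prop) measurableSet_Iio]
      congr 1
      ext x; simp
    simp only
    rw [h3]
    refine ENNReal.toReal_mono (measure_ne_top _ _) (gaussian_Iio_le ?_)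
    refine hμ.trans ?_
    have h4 : ipm v θ = (∑ i, ∑ j, θ i j) / N := by
      simp only [ipm, v, Finset.sum_div]
      simp [div_eq_inv_mul]
    rw [h4]
    gcongr
    have h5 : ∀ i j, (if i ∈ R then if j ∈ C then A else 0 else 0) ≤ θ i j := by
      intro i j
      split_ifs with hi hj
      · exact hθ i j hi hj
      · exact (hθ0 i j (by tauto)).ge
      · exact (hθ0 i j (by tauto)).ge
    calc (n : ℝ) ^ 2 * A = ∑ i, ∑ j, (if i ∈ R then if j ∈ C then A else 0 else 0) := by
          have : ∀ i, ∑ j, (if i ∈ R then if j ∈ C then A else 0 else 0)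
              = if i ∈ R then (n : ℝ) * A else 0 := by
            intro i
            split_ifs
            · rw [Finset.sum_ite_mem]; simp [hC]
            · simp
          simp_rw [this]
          rw [Finset.sum_ite_mem]; simp [hR]; ring
      _ ≤ _ := Finset.sum_le_sum fun i _ => Finset.sum_le_sum fun j _ => h5 i j
  have e2 : (⨆ θ : ThetaSet A n N, (PTheta N θ.1 {x | 0 ≤ ipm v x}ᶜ).toReal)
      ≤ (gaussianReal 0 1 (Set.Iio (-μ))).toReal :=
    Real.iSup_le e1 ENNReal.toReal_nonneg
  unfold testRisk
  rw [e0]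
  have e3 : (gaussianReal 0 1).real (Set.Iio (-μ)) + (gaussianReal 0 1).real (Set.Ico (-μ) 0)
      + (gaussianReal 0 1).real (Set.Ici 0) = 1 := by
    rw [← measureReal_union _ measurableSet_Ico, Set.Iio_union_Ico_eq_Iio (by linarith),
      ← measureReal_union _ measurableSet_Ici, Set.Iio_union_Ici]
    · simp
    · exact Set.disjoint_left.2 fun x hx hx' => by simp at hx hx'; linarith
    · exact Set.disjoint_left.2 fun x hx hx' => by simp at hx hx'; linarith
  have e4 := gaussian_Ico_ge h0 h1
  simp only [Measure.real] at e3
  linarith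

/-! ### Overlap of random subsets -/

lemma choose_bound (N n : ℕ) (hn : n ≤ N) (s : ℕ) (hs : s ≤ n) :
    (N - s).choose (n - s) * N ^ s ≤ N.choose n * n ^ s := by
  induction s with
  | zero => simp
  | succ s ih =>
    have ih := ih (by omega)
    obtain ⟨a, ha⟩ : ∃ a, N - s = a + 1 := ⟨N - s - 1, by omega⟩
    obtain ⟨b, hb⟩ : ∃ b, n - s = b + 1 := ⟨n - s - 1, by omega⟩
    have e1 : N - (s + 1) = a := by omega
    have e2 : n - (s + 1) = b := by omega
    rw [e1, e2]
    rw [ha, hb] at ih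
    have e3 := Nat.add_one_mul_choose_eq a b
    have e4 : N * (b + 1) ≤ n * (a + 1) := by
      have h1 : N = a + 1 + s := by omega
      have h2 : n = b + 1 + s := by omega
      have h3 : b ≤ a := by omega
      subst h1 h2
      nlinarith
    refine Nat.le_of_mul_le_mul_left (?_ : (a + 1) * _ ≤ (a + 1) * _) (Nat.succ_pos a)
    calc (a + 1) * (a.choose b * N ^ (s + 1))
        = ((a + 1) * a.choose b) * (N ^ s * N) := by ring
      _ = ((a + 1).choose (b + 1) * N ^ s) * (N * (b + 1)) := by rw [e3]; ring
      _ ≤ (N.choose n * n ^ s) * (n * (a + 1)) := Nat.mul_le_mul ih e4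
      _ = _ := by ring

/-- The family of `n`-subsets of `[N]`. -/
def fam (n N : ℕ) : Finset (Finset (Fin N)) := Finset.powersetCard n Finset.univ

lemma card_fam (n N : ℕ) : (fam n N).card = N.choose n := by simp [fam]

lemma mem_fam {n N : ℕ} {R : Finset (Fin N)} : R ∈ fam n N ↔ R.card = n := by simp [fam]

lemma sum_one_add_pow (n N : ℕ) (hn : n ≤ N) (hN : 0 < N) (R : Finset (Fin N)) (hR : R.card = n)
    (x : ℝ) (hx : 0 ≤ x) :
    ∑ R' ∈ fam n N, (1 + x) ^ (R ∩ R').card ≤ (fam n N).card * (1 + x * ((n : ℝ) / N)) ^ n := by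
  have hN' : (0 : ℝ) < N := by exact_mod_cast hN
  have h1 : ∀ (S : Finset (Fin N)) (y : ℝ), (1 + y) ^ S.card = ∑ U ∈ S.powerset, y ^ U.card := by
    intro S y
    have := Finset.prod_one_add (f := fun _ : Fin N => y) S
    simpa using this
  have h2 : ∀ R' ∈ fam n N, (1 + x) ^ (R ∩ R').card
      = ∑ U ∈ R.powerset, if U ⊆ R' then x ^ U.card else 0 := by
    intro R' _
    rw [h1, ← Finset.sum_filter]
    refine Finset.sum_congr ?_ fun _ _ => rfl
    ext U
    simp only [Finset.mem_powerset, Finset.mem_filter, Finset.subset_inter_iff]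
  rw [Finset.sum_congr rfl h2, Finset.sum_comm, ← hR, h1, Finset.mul_sum]
  refine Finset.sum_le_sum fun U hU => ?_
  have hUn : U.card ≤ n := hR ▸ Finset.card_le_card (Finset.mem_powerset.1 hU)
  rw [← Finset.sum_filter, Finset.sum_const, nsmul_eq_mul, hR]
  have h3 : ((fam n N).filter (U ⊆ ·)).card = (N - U.card).choose (n - U.card) := by
    have := Finset.card_filter_powersetCard_subset U Finset.univ n (Finset.subset_univ _) hUn
    simpa [fam] using this
  rw [h3, card_fam, mul_pow, div_pow]
  have h4 : (((N - U.card).choose (n - U.card) : ℕ) : ℝ) * (N : ℝ) ^ U.card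
      ≤ (N.choose n : ℝ) * (n : ℝ) ^ U.card := by
    exact_mod_cast choose_bound N n hn U.card hUn
  rw [← le_div_iff₀ (by positivity)] at h4
  calc _ ≤ (N.choose n : ℝ) * (n : ℝ) ^ U.card / (N : ℝ) ^ U.card * x ^ U.card := by gcongr
    _ = _ := by ring

lemma sum_exp_overlap (n N : ℕ) (hn : n ≤ N) (hN : 0 < N) (R : Finset (Fin N)) (hR : R.card = n)
    (q : ℝ) (hq : (n : ℝ) ^ 2 / N ≤ q) (t : ℝ) (ht : 0 ≤ t) :
    ∑ R' ∈ fam n N, rexp (t * (R ∩ R').card) ≤ (fam n N).card * rexp (q * (rexp t - 1)) := by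
  have hN' : (0 : ℝ) < N := by exact_mod_cast hN
  have h1 : 0 ≤ rexp t - 1 := by linarith [Real.add_one_le_exp t]
  have h := sum_one_add_pow n N hn hN R hR (rexp t - 1) h1
  have e : ∀ R' : Finset (Fin N), rexp (t * (R ∩ R').card) = (1 + (rexp t - 1)) ^ (R ∩ R').card := by
    intro R'
    rw [add_sub_cancel, ← Real.exp_nat_mul, mul_comm]
  simp_rw [e]
  refine h.trans ?_
  gcongr
  calc (1 + (rexp t - 1) * ((n : ℝ) / N)) ^ n ≤ (rexp ((rexp t - 1) * ((n : ℝ) / N))) ^ n := by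
        gcongr
        linarith [Real.add_one_le_exp ((rexp t - 1) * ((n : ℝ) / N))]
    _ = rexp ((n : ℝ) ^ 2 / N * (rexp t - 1)) := by
        rw [← Real.exp_nat_mul]; congr 1; ring
    _ ≤ _ := by gcongr

/-- The combined overlap bound. `a` plays the role of `A²`, `h` of `n/8`, `r` the truncated rate. -/
lemma overlap_bound (n N : ℕ) (hn : n ≤ N) (hN : 0 < N) (R C : Finset (Fin N)) (hR : R.card = n)
    (hC : C.card = n) (q a m h s r u : ℝ) (hq0 : 0 ≤ q) (hq : (n : ℝ) ^ 2 / N ≤ q)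
    (ha : 0 ≤ a) (hm : a * m ≤ 1) (hmh : m ≤ h) (h0 : 0 ≤ h) (hs : 0 ≤ s) (hr : 0 ≤ r) (hu : 0 ≤ u)
    (hqa : 2 * q * a ≤ 1)
    (F : Finset (Fin N) → Finset (Fin N) → ℝ)
    (hF1 : ∀ R' ∈ fam n N, ∀ C' ∈ fam n N,
      F R' C' ≤ rexp (a * ((R ∩ R').card * (C ∩ C').card)))
    (hF2 : ∀ R' ∈ fam n N, ∀ C' ∈ fam n N, h < (R ∩ R').card → h < (C ∩ C').card →
      F R' C' ≤ rexp (r * ((R ∩ R').card * (C ∩ C').card))) :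
    ∑ R' ∈ fam n N, ∑ C' ∈ fam n N, F R' C' ≤ ((fam n N).card : ℝ) ^ 2 *
      (rexp (4 * q ^ 2 * a) + 2 * (rexp (-(s * m)) * rexp (q * rexp (a * h + s)))
        + rexp (-(u * (2 * h))) * rexp (q * rexp (r * n / 2 + u)) ^ 2) := by
  set K : ℝ := ((fam n N).card : ℝ) with hK
  have hK0 : 0 ≤ K := by positivity
  -- pointwise bound
  have hpt : ∀ R' ∈ fam n N, ∀ C' ∈ fam n N, F R' C' ≤
      (if ((C ∩ C').card : ℝ) ≤ m then rexp (a * ((R ∩ R').card * (C ∩ C').card)) else 1)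
      + (rexp (-(s * m)) * rexp ((a * h + s) * (C ∩ C').card)
        + rexp (-(s * m)) * rexp ((a * h + s) * (R ∩ R').card))
      + rexp (-(u * (2 * h))) * (rexp ((r * n / 2 + u) * (R ∩ R').card)
        * rexp ((r * n / 2 + u) * (C ∩ C').card)) := by
    intro R' hR' C' hC'
    have f1 := hF1 R' hR' C' hC'
    have f2 := hF2 R' hR' C' hC'
    have k1 : ((R ∩ R').card : ℝ) ≤ n := by
      rw [← hR]; exact_mod_cast Finset.card_le_card Finset.inter_subset_left
    have k2 : ((C ∩ C').card : ℝ) ≤ n := by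
      rw [← hC]; exact_mod_cast Finset.card_le_card Finset.inter_subset_left
    have k3 : (0 : ℝ) ≤ (R ∩ R').card := by positivity
    have k4 : (0 : ℝ) ≤ (C ∩ C').card := by positivity
    set k : ℝ := ((R ∩ R').card : ℝ)
    set l : ℝ := ((C ∩ C').card : ℝ)
    simp only [← Real.exp_add]
    have p1 := Real.exp_pos (-(s * m) + (a * h + s) * l)
    have p2 := Real.exp_pos (-(s * m) + (a * h + s) * k)
    have p3 := Real.exp_pos (-(u * (2 * h)) + ((r * n / 2 + u) * k + (r * n / 2 + u) * l))
    by_cases c1 : l ≤ m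
    · rw [if_pos c1]; linarith
    rw [if_neg c1]
    push Not at c1
    by_cases c2 : k ≤ h
    · have : F R' C' ≤ rexp (-(s * m) + (a * h + s) * l) := by
        refine f1.trans (Real.exp_le_exp.2 ?_)
        have := mul_le_mul_of_nonneg_left (mul_le_mul_of_nonneg_right c2 k4) ha
        have := mul_le_mul_of_nonneg_left c1.le hs
        linarith
      linarith
    push Not at c2
    by_cases c3 : l ≤ h
    · have : F R' C' ≤ rexp (-(s * m) + (a * h + s) * k) := by
        refine f1.trans (Real.exp_le_exp.2 ?_)
        have := mul_le_mul_of_nonneg_left (mul_le_mul_of_nonneg_left c3 k3) ha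
        have := mul_le_mul_of_nonneg_left (hmh.trans c2.le) hs
        linarith
      linarith
    push Not at c3
    have : F R' C' ≤ rexp (-(u * (2 * h)) + ((r * n / 2 + u) * k + (r * n / 2 + u) * l)) := by
      refine (f2 c2 c3).trans (Real.exp_le_exp.2 ?_)
      have w1 := mul_le_mul_of_nonneg_left c2.le hu
      have w2 := mul_le_mul_of_nonneg_left c3.le hu
      have w3 := mul_le_mul_of_nonneg_left (mul_le_mul_of_nonneg_left k1 k4) hr
      have w4 := mul_le_mul_of_nonneg_left (mul_le_mul_of_nonneg_left k2 k3) hr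
      linarith
    linarith
  have step : ∑ R' ∈ fam n N, ∑ C' ∈ fam n N, F R' C' ≤ _ :=
    Finset.sum_le_sum fun R' hR' => Finset.sum_le_sum fun C' hC' => hpt R' hR' C' hC'
  refine step.trans ?_
  simp only [Finset.sum_add_distrib]
  have b1 : ∑ R' ∈ fam n N, ∑ C' ∈ fam n N,
      (if ((C ∩ C').card : ℝ) ≤ m then rexp (a * ((R ∩ R').card * (C ∩ C').card)) else 1)
      ≤ K ^ 2 * rexp (4 * q ^ 2 * a) := by
    rw [Finset.sum_comm]
    have inner : ∀ C' ∈ fam n N, ∑ R' ∈ fam n N,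
        (if ((C ∩ C').card : ℝ) ≤ m then rexp (a * ((R ∩ R').card * (C ∩ C').card)) else 1)
        ≤ K * rexp ((2 * q * a) * (C ∩ C').card) := by
      intro C' _
      have k4 : (0 : ℝ) ≤ (C ∩ C').card := by positivity
      set l : ℝ := ((C ∩ C').card : ℝ)
      split_ifs with c
      · have hal : 0 ≤ a * l := by positivity
        have hal1 : a * l ≤ 1 := (mul_le_mul_of_nonneg_left c ha).trans hm
        have := sum_exp_overlap n N hn hN R hR q hq (a * l) hal
        have e : ∀ R' : Finset (Fin N), a * (((R ∩ R').card : ℝ) * l) = a * l * (R ∩ R').card := by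
          intro R'; ring
        simp_rw [e]
        refine this.trans ?_
        refine mul_le_mul_of_nonneg_left (Real.exp_le_exp.2 ?_) hK0
        have hb : rexp (a * l) - 1 ≤ 2 * (a * l) := by
          have := Real.abs_exp_sub_one_le (x := a * l) (by rw [abs_of_nonneg hal]; exact hal1)
          rw [abs_of_nonneg hal] at this
          exact (le_abs_self _).trans this
        have := mul_le_mul_of_nonneg_left hb hq0
        linarith
      · simp only [Finset.sum_const, nsmul_eq_mul, mul_one]
        have : 1 ≤ rexp (2 * q * a * l) := Real.one_le_exp (by positivity)
        exact le_mul_of_one_le_right hK0 this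
    refine (Finset.sum_le_sum inner).trans ?_
    rw [← Finset.mul_sum, sq, mul_assoc K K]
    refine mul_le_mul_of_nonneg_left ?_ hK0
    have hqa0 : 0 ≤ 2 * q * a := by positivity
    refine (sum_exp_overlap n N hn hN C hC q hq (2 * q * a) hqa0).trans ?_
    refine mul_le_mul_of_nonneg_left (Real.exp_le_exp.2 ?_) hK0
    have hb : rexp (2 * q * a) - 1 ≤ 2 * (2 * q * a) := by
      have := Real.abs_exp_sub_one_le (x := 2 * q * a) (by rw [abs_of_nonneg hqa0]; exact hqa)
      rw [abs_of_nonneg hqa0] at this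
      exact (le_abs_self _).trans this
    have := mul_le_mul_of_nonneg_left hb hq0
    linarith
  have gen : ∀ S : Finset (Fin N), S.card = n → ∀ t, 0 ≤ t →
      ∑ R' ∈ fam n N, rexp (t * (S ∩ R').card) ≤ K * rexp (q * rexp t) := by
    intro S hS t ht
    refine (sum_exp_overlap n N hn hN S hS q hq t ht).trans ?_
    gcongr
    linarith
  have t1 : 0 ≤ a * h + s := by positivity
  have t2 : 0 ≤ r * n / 2 + u := by positivity
  have b2 : ∑ R' ∈ fam n N, ∑ C' ∈ fam n N, rexp (-(s * m)) * rexp ((a * h + s) * (C ∩ C').card)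
      ≤ K ^ 2 * (rexp (-(s * m)) * rexp (q * rexp (a * h + s))) := by
    rw [Finset.sum_const, nsmul_eq_mul, ← hK, ← Finset.mul_sum]
    have := mul_le_mul_of_nonneg_left (gen C hC _ t1) (Real.exp_pos (-(s * m))).le
    have := mul_le_mul_of_nonneg_left this hK0
    linarith
  have b3 : ∑ R' ∈ fam n N, ∑ C' ∈ fam n N, rexp (-(s * m)) * rexp ((a * h + s) * (R ∩ R').card)
      ≤ K ^ 2 * (rexp (-(s * m)) * rexp (q * rexp (a * h + s))) := by
    rw [Finset.sum_comm, Finset.sum_const, nsmul_eq_mul, ← hK, ← Finset.mul_sum]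
    have := mul_le_mul_of_nonneg_left (gen R hR _ t1) (Real.exp_pos (-(s * m))).le
    have := mul_le_mul_of_nonneg_left this hK0
    linarith
  have b4 : ∑ R' ∈ fam n N, ∑ C' ∈ fam n N,
      rexp (-(u * (2 * h))) * (rexp ((r * n / 2 + u) * (R ∩ R').card)
        * rexp ((r * n / 2 + u) * (C ∩ C').card))
      ≤ K ^ 2 * (rexp (-(u * (2 * h))) * rexp (q * rexp (r * n / 2 + u)) ^ 2) := by
    simp_rw [← Finset.mul_sum]
    rw [← Finset.sum_mul]
    have g1 := gen R hR _ t2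
    have g2 := gen C hC _ t2
    have := mul_le_mul g1 g2 (Finset.sum_nonneg fun _ _ => (Real.exp_pos _).le) (by positivity)
    have := mul_le_mul_of_nonneg_left this (Real.exp_pos (-(u * (2 * h)))).le
    linarith
  linarith

/-! ### Truncated second moment method -/

lemma sq_integral_abs_le {Ω : Type*} [MeasurableSpace Ω] (μ : Measure Ω) [IsProbabilityMeasure μ]
    (f : Ω → ℝ) (hf : Integrable f μ) (hf2 : Integrable (fun x => f x ^ 2) μ) :
    ∫ x, |f x| ∂μ ≤ √(∫ x, f x ^ 2 ∂μ) := by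
  refine Real.le_sqrt_of_sq_le ?_
  set c := ∫ x, |f x| ∂μ
  have h0 : 0 ≤ ∫ x, (|f x| - c) ^ 2 ∂μ := integral_nonneg fun x => sq_nonneg _
  have e : ∀ x, (|f x| - c) ^ 2 = f x ^ 2 - (2 * c) * |f x| + c ^ 2 := by
    intro x; rw [sub_sq, sq_abs]; ring
  simp_rw [e] at h0
  have hsub : Integrable (fun x => f x ^ 2 - 2 * c * |f x|) μ := hf2.sub (hf.abs.const_mul _)
  rw [integral_add hsub (integrable_const _),
    integral_sub hf2 (hf.abs.const_mul _), integral_const_mul] at h0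
  simp only [integral_const, probReal_univ, smul_eq_mul, one_mul] at h0
  change 0 ≤ _ - 2 * c * c + c ^ 2 at h0
  linarith

lemma second_moment {Ω ι : Type*} [MeasurableSpace Ω] (μ : Measure Ω) [IsProbabilityMeasure μ]
    (I : Finset ι) (L : ι → Ω → ℝ) (Γ : ι → Set Ω) (b V : ℝ)
    (hL0 : ∀ i x, 0 ≤ L i x) (hL : ∀ i, Integrable (L i) μ) (hL1 : ∀ i, ∫ x, L i x ∂μ = 1)
    (hΓ : ∀ i, MeasurableSet (Γ i))
    (hLL : ∀ i j, Integrable (fun x => (Γ i).indicator (L i) x * (Γ j).indicator (L j) x) μ)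
    (hb : ∀ i ∈ I, ∫ x in (Γ i)ᶜ, L i x ∂μ ≤ b)
    (hV : ∑ i ∈ I, ∑ j ∈ I, ∫ x, (Γ i).indicator (L i) x * (Γ j).indicator (L j) x ∂μ
      ≤ (I.card : ℝ) ^ 2 * (1 + V))
    (T : Set Ω) (hT : MeasurableSet T) :
    ∑ i ∈ I, ∫ x in T, L i x ∂μ ≤ I.card * (μ.real T + b + √(V + 2 * b)) := by
  set K : ℝ := (I.card : ℝ) with hK
  have hK0 : 0 ≤ K := by positivity
  set g : ι → Ω → ℝ := fun i => (Γ i).indicator (L i) with hg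
  have hgi : ∀ i, Integrable (g i) μ := fun i => (hL i).indicator (hΓ i)
  have hgint : ∀ i, ∫ x, g i x ∂μ = 1 - ∫ x in (Γ i)ᶜ, L i x ∂μ := by
    intro i
    rw [hg]; simp only
    rw [integral_indicator (hΓ i), ← hL1 i, ← integral_add_compl (hΓ i) (hL i)]
    ring
  set f : Ω → ℝ := fun x => ∑ i ∈ I, g i x - K with hf
  have hfi : Integrable f μ := (integrable_finsetSum _ fun i _ => hgi i).sub (integrable_const _)
  have hfsq : ∀ x, f x ^ 2 = ∑ i ∈ I, ∑ j ∈ I, g i x * g j x - 2 * K * ∑ i ∈ I, g i x + K ^ 2 := by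
    intro x
    rw [hf]; simp only
    rw [← Finset.sum_mul_sum]; ring
  have hd : Integrable (fun x => ∑ i ∈ I, ∑ j ∈ I, g i x * g j x) μ :=
    integrable_finsetSum _ fun i _ => integrable_finsetSum _ fun j _ => hLL i j
  have hs : Integrable (fun x => ∑ i ∈ I, g i x) μ := integrable_finsetSum _ fun i _ => hgi i
  have hf2 : Integrable (fun x => f x ^ 2) μ := by
    simp_rw [hfsq]
    exact (hd.sub (hs.const_mul _)).add (integrable_const _)
  have hsum : K * (1 - b) ≤ ∑ i ∈ I, ∫ x, g i x ∂μ := by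
    rw [hK, ← nsmul_eq_mul]
    refine Finset.card_nsmul_le_sum _ _ _ fun i hi => ?_
    rw [hgint]; linarith [hb i hi]
  have h_sq_int : ∫ x, f x ^ 2 ∂μ ≤ K ^ 2 * (V + 2 * b) := by
    simp_rw [hfsq]
    have hsub : Integrable (fun x => ∑ i ∈ I, ∑ j ∈ I, g i x * g j x - 2 * K * ∑ i ∈ I, g i x) μ :=
      hd.sub (hs.const_mul _)
    rw [integral_add hsub (integrable_const _),
      integral_sub hd (hs.const_mul _), integral_const_mul,
      integral_finsetSum _ (fun i _ => integrable_finsetSum _ fun j _ => hLL i j),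
      integral_finsetSum _ (fun i _ => hgi i)]
    have : ∀ i ∈ I, ∫ x, ∑ j ∈ I, g i x * g j x ∂μ = ∑ j ∈ I, ∫ x, g i x * g j x ∂μ :=
      fun i _ => integral_finsetSum _ (fun j _ => hLL i j)
    rw [Finset.sum_congr rfl this]
    simp only [integral_const, probReal_univ, smul_eq_mul, one_mul]
    have := mul_le_mul_of_nonneg_left hsum hK0
    nlinarith [hV]
  have hTf : ∫ x in T, f x ∂μ ≤ K * √(V + 2 * b) := by
    calc ∫ x in T, f x ∂μ ≤ ∫ x in T, |f x| ∂μ :=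
          setIntegral_mono hfi.integrableOn hfi.abs.integrableOn fun x => le_abs_self _
      _ ≤ ∫ x, |f x| ∂μ := setIntegral_le_integral hfi.abs
          (Filter.Eventually.of_forall fun x => abs_nonneg _)
      _ ≤ √(∫ x, f x ^ 2 ∂μ) := sq_integral_abs_le μ f hfi hf2
      _ ≤ √(K ^ 2 * (V + 2 * b)) := Real.sqrt_le_sqrt h_sq_int
      _ = K * √(V + 2 * b) := by rw [Real.sqrt_mul (sq_nonneg K), Real.sqrt_sq hK0]
  have hTf2 : ∫ x in T, f x ∂μ = ∑ i ∈ I, ∫ x in T, g i x ∂μ - K * μ.real T := by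
    rw [hf]; simp only
    rw [integral_sub hs.integrableOn (integrable_const _),
      integral_finsetSum _ (fun i _ => (hgi i).integrableOn)]
    simp [mul_comm]
  have hLg : ∀ i ∈ I, ∫ x in T, L i x ∂μ ≤ ∫ x in T, g i x ∂μ + b := by
    intro i hi
    have h1 : ∫ x in T, (L i x - g i x) ∂μ ≤ ∫ x, (L i x - g i x) ∂μ := by
      refine setIntegral_le_integral ((hL i).sub (hgi i)) (Filter.Eventually.of_forall fun x => ?_)
      exact sub_nonneg.2 (Set.indicator_le_self' (fun _ _ => hL0 i _) x)
    rw [integral_sub (hL i).integrableOn (hgi i).integrableOn, integral_sub (hL i) (hgi i),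
      hL1, hgint] at h1
    linarith [hb i hi]
  have hfin := Finset.sum_le_sum hLg
  rw [Finset.sum_add_distrib, Finset.sum_const, nsmul_eq_mul, ← hK] at hfin
  linarith

/-- Indicator matrix. -/
def indm {N : ℕ} (R C : Finset (Fin N)) : Fin N → Fin N → ℝ :=
  fun i j => if i ∈ R then (if j ∈ C then 1 else 0) else 0

lemma ipm_indm {N : ℕ} (R C R' C' : Finset (Fin N)) :
    ipm (indm R C) (indm R' C') = (R ∩ R').card * (C ∩ C').card := by
  have : ∀ i j, indm R C i j * indm R' C' i j
      = (if i ∈ R ∩ R' then 1 else 0) * (if j ∈ C ∩ C' then (1 : ℝ) else 0) := by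
    intro i j
    simp only [indm, Finset.mem_inter]
    by_cases h1 : i ∈ R <;> by_cases h2 : i ∈ R' <;> by_cases h3 : j ∈ C <;> by_cases h4 : j ∈ C' <;>
      simp [h1, h2, h3, h4]
  simp only [ipm, this]
  rw [← Finset.sum_mul_sum]
  simp only [Finset.sum_ite_mem, Finset.univ_inter, Finset.sum_const, nsmul_eq_mul, mul_one]

/-- Truncation event. -/
def trunc {N : ℕ} (A ε h : ℝ) (R C : Finset (Fin N)) : Set (Fin N → Fin N → ℝ) :=
  {x | ∀ p ∈ (R.powerset ×ˢ C.powerset).filter (fun p => h < p.1.card ∧ h < p.2.card),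
    ipm (indm p.1 p.2) x ≤ (1 + ε) * A * (p.1.card * p.2.card)}

lemma measurableSet_trunc {N : ℕ} (A ε h : ℝ) (R C : Finset (Fin N)) :
    MeasurableSet (trunc A ε h R C) := by
  have : trunc A ε h R C = ⋂ p ∈ (R.powerset ×ˢ C.powerset).filter
      (fun p => h < p.1.card ∧ h < p.2.card),
      {x | ipm (indm p.1 p.2) x ≤ (1 + ε) * A * (p.1.card * p.2.card)} := by
    ext x; simp only [trunc, Set.mem_ofPred_eq, Set.mem_iInter]
  rw [this]
  exact Finset.measurableSet_biInter _ fun p _ => measurableSet_le (by fun_prop) measurable_const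

lemma measurable_LR {N : ℕ} (θ : Fin N → Fin N → ℝ) : Measurable (LR θ) := by
  unfold LR; fun_prop

lemma trunc_compl_bound {N n : ℕ} (A ε h : ℝ) (R C : Finset (Fin N)) (hh : 0 ≤ h) (hpos : 0 ≤ ε * A)
    (hR : R.card = n) (hC : C.card = n) :
    ∫ x in (trunc A ε h R C)ᶜ, LR (A • indm R C) x ∂(PTheta N 0)
      ≤ 4 ^ n * rexp (-(ε ^ 2 * A ^ 2 * h ^ 2 / 2)) := by
  set J := (R.powerset ×ˢ C.powerset).filter (fun p => h < p.1.card ∧ h < p.2.card) with hJ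
  set θ := A • indm R C
  set w : Finset (Fin N) × Finset (Fin N) → (Fin N → Fin N → ℝ) → ℝ := fun p x =>
    rexp (ipm (θ + (ε * A) • indm p.1 p.2) x
      + (-(ipm θ θ / 2) - ε * A * ((1 + ε) * A * (p.1.card * p.2.card)))) with hw
  have hwi : ∀ p, Integrable (w p) (PTheta N 0) := fun p => integrable_exp_ipm N _ _
  have hwint : ∀ p ∈ J, ∫ x, w p x ∂(PTheta N 0) ≤ rexp (-(ε ^ 2 * A ^ 2 * h ^ 2 / 2)) := by
    intro p hp
    simp only [hJ, Finset.mem_filter, Finset.mem_product, Finset.mem_powerset] at hp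
    obtain ⟨⟨h1, h2⟩, h3, h4⟩ := hp
    rw [hw]; simp only
    rw [integral_exp_ipm, Real.exp_le_exp]
    simp only [ipm_add_left, ipm_add_right, ipm_smul_left, ipm_smul_right, θ, ipm_indm,
      Finset.inter_eq_right.2 h1, Finset.inter_eq_right.2 h2, Finset.inter_eq_left.2 h1,
      Finset.inter_eq_left.2 h2, Finset.inter_self]
    have h5 : h ^ 2 ≤ (p.1.card : ℝ) * p.2.card := by
      rw [sq]; exact mul_le_mul h3.le h4.le hh (by positivity)
    have := mul_le_mul_of_nonneg_left h5 (by positivity : 0 ≤ ε ^ 2 * A ^ 2)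
    nlinarith
  have hpt : ∀ x, (trunc A ε h R C)ᶜ.indicator (LR θ) x ≤ ∑ p ∈ J, w p x := by
    intro x
    by_cases hx : x ∈ (trunc A ε h R C)ᶜ
    · rw [Set.indicator_of_mem hx]
      simp only [trunc, Set.mem_compl_iff, Set.mem_ofPred_eq, not_forall, not_le] at hx
      obtain ⟨p, hp, hlt⟩ := hx
      refine le_trans ?_ (Finset.single_le_sum (f := fun p => w p x)
        (fun p _ => (Real.exp_pos _).le) hp)
      simp only [LR, hw]
      rw [Real.exp_le_exp, ipm_add_left, ipm_smul_left (ε * A)]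
      nlinarith [mul_le_mul_of_nonneg_left hlt.le hpos]
    · rw [Set.indicator_of_notMem hx]
      exact Finset.sum_nonneg fun p _ => (Real.exp_pos _).le
  rw [← integral_indicator (measurableSet_trunc A ε h R C).compl]
  have hLi : Integrable (LR θ) (PTheta N 0) := integrable_exp_ipm' N θ
  calc _ ≤ ∫ x, ∑ p ∈ J, w p x ∂(PTheta N 0) :=
        integral_mono (hLi.indicator (measurableSet_trunc A ε h R C).compl)
          (integrable_finsetSum _ fun p _ => hwi p) hpt
    _ = ∑ p ∈ J, ∫ x, w p x ∂(PTheta N 0) := integral_finsetSum _ fun p _ => hwi p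
    _ ≤ J.card • rexp (-(ε ^ 2 * A ^ 2 * h ^ 2 / 2)) := Finset.sum_le_card_nsmul _ _ _ hwint
    _ ≤ _ := by
        rw [nsmul_eq_mul]
        gcongr
        have h1 : J.card ≤ (R.powerset ×ˢ C.powerset).card := Finset.card_filter_le _ _
        rw [Finset.card_product, Finset.card_powerset, Finset.card_powerset, hR, hC, ← mul_pow] at h1
        exact_mod_cast h1

lemma integrable_LR_mul {N : ℕ} (θ θ' : Fin N → Fin N → ℝ) :
    Integrable (fun x => LR θ x * LR θ' x) (PTheta N 0) := by
  refine (integrable_exp_ipm N (θ + θ') (-(ipm θ θ / 2) - ipm θ' θ' / 2)).congr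
    (Filter.Eventually.of_forall fun x => ?_)
  simp only [LR, ← Real.exp_add, ipm_add_left]
  congr 1; ring

lemma integrable_trunc_mul {N : ℕ} (θ θ' : Fin N → Fin N → ℝ) {G G' : Set (Fin N → Fin N → ℝ)}
    (hG : MeasurableSet G) (hG' : MeasurableSet G') :
    Integrable (fun x => G.indicator (LR θ) x * G'.indicator (LR θ') x) (PTheta N 0) := by
  refine ((integrable_LR_mul θ θ').indicator (hG.inter hG')).congr
    (Filter.Eventually.of_forall fun x => ?_)
  simp only
  rw [Set.inter_indicator_mul]

lemma indicator_mul_le {N : ℕ} (θ θ' : Fin N → Fin N → ℝ) (G G' : Set (Fin N → Fin N → ℝ))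
    (x : Fin N → Fin N → ℝ) :
    G.indicator (LR θ) x * G'.indicator (LR θ') x ≤ LR θ x * LR θ' x := by
  have h1 : ∀ θ y, 0 ≤ LR (N := N) θ y := fun θ y => (Real.exp_pos _).le
  exact mul_le_mul (Set.indicator_le_self' (fun _ _ => h1 _ _) x)
    (Set.indicator_le_self' (fun _ _ => h1 _ _) x) (Set.indicator_nonneg (fun _ _ => h1 _ _) x)
    (h1 _ _)

lemma cross_bound1 {N : ℕ} (A : ℝ) (R C R' C' : Finset (Fin N)) {G G' : Set (Fin N → Fin N → ℝ)}
    (hG : MeasurableSet G) (hG' : MeasurableSet G') :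
    ∫ x, G.indicator (LR (A • indm R C)) x * G'.indicator (LR (A • indm R' C')) x ∂(PTheta N 0)
      ≤ rexp (A ^ 2 * ((R ∩ R').card * (C ∩ C').card)) := by
  refine (integral_mono (integrable_trunc_mul _ _ hG hG') (integrable_LR_mul _ _)
    (indicator_mul_le _ _ _ _)).trans ?_
  set θ := A • indm R C with hθ
  set θ' := A • indm R' C' with hθ'
  have e : ∀ x, LR θ x * LR θ' x
      = rexp (ipm (θ + θ') x + (-(ipm θ θ / 2) - ipm θ' θ' / 2)) := by
    intro x
    simp only [LR, ← Real.exp_add, ipm_add_left]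
    congr 1; ring
  simp_rw [e]
  rw [integral_exp_ipm, Real.exp_le_exp]
  simp only [ipm_add_left, ipm_add_right, ipm_comm θ' θ]
  have : ipm θ θ' = A ^ 2 * ((R ∩ R').card * (C ∩ C').card) := by
    rw [hθ, hθ', ipm_smul_left, ipm_smul_right, ipm_indm]; ring
  linarith

lemma cross_bound2 {N : ℕ} (A ε h : ℝ) (hA : 0 ≤ A) (R C R' C' : Finset (Fin N))
    (h1 : h < (R ∩ R').card) (h2 : h < (C ∩ C').card) :
    ∫ x, (trunc A ε h R C).indicator (LR (A • indm R C)) x *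
        (trunc A ε h R' C').indicator (LR (A • indm R' C')) x ∂(PTheta N 0)
      ≤ rexp (A ^ 2 * (1 / 2 + ε) * ((R ∩ R').card * (C ∩ C').card)) := by
  set θ := A • indm R C with hθ
  set θ' := A • indm R' C' with hθ'
  set σ := indm (R ∩ R') (C ∩ C') with hσ
  set k : ℝ := ((R ∩ R').card : ℝ) * (C ∩ C').card with hk
  have e1 : ipm θ θ' = A ^ 2 * k := by
    rw [hθ, hθ', ipm_smul_left, ipm_smul_right, ipm_indm]; ring
  have e2 : ipm θ σ = A * k := by
    rw [hθ, hσ, ipm_smul_left, ipm_indm]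
    rw [Finset.inter_eq_right.2 Finset.inter_subset_left,
      Finset.inter_eq_right.2 Finset.inter_subset_left]
  have e3 : ipm θ' σ = A * k := by
    rw [hθ', hσ, ipm_smul_left, ipm_indm]
    rw [Finset.inter_eq_right.2 Finset.inter_subset_right,
      Finset.inter_eq_right.2 Finset.inter_subset_right]
  have e4 : ipm σ σ = k := by
    rw [hσ, ipm_indm, Finset.inter_self, Finset.inter_self]
  have hpt : ∀ x, (trunc A ε h R C).indicator (LR θ) x * (trunc A ε h R' C').indicator (LR θ') x
      ≤ rexp (ipm (θ + θ' + (-A) • σ) x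
        + (-(ipm θ θ / 2) - ipm θ' θ' / 2 + A * ((1 + ε) * A * k))) := by
    intro x
    by_cases hx : x ∈ trunc A ε h R C
    · refine (indicator_mul_le _ _ _ _ x).trans ?_
      have hx' : ipm σ x ≤ (1 + ε) * A * k := hx (R ∩ R', C ∩ C') (by
        simp only [Finset.mem_filter, Finset.mem_product, Finset.mem_powerset]
        exact ⟨⟨Finset.inter_subset_left, Finset.inter_subset_left⟩, h1, h2⟩)
      simp only [LR, ← Real.exp_add, ipm_add_left, ipm_smul_left]
      rw [Real.exp_le_exp]
      nlinarith [mul_le_mul_of_nonneg_left hx' hA]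
    · rw [Set.indicator_of_notMem hx, zero_mul]
      exact (Real.exp_pos _).le
  refine (integral_mono (integrable_trunc_mul _ _ (measurableSet_trunc _ _ _ _ _)
    (measurableSet_trunc _ _ _ _ _)) (integrable_exp_ipm N _ _) hpt).trans ?_
  rw [integral_exp_ipm, Real.exp_le_exp]
  simp only [ipm_add_left, ipm_add_right, ipm_smul_left, ipm_smul_right, ipm_comm θ' θ,
    ipm_comm σ θ, ipm_comm σ θ', e1, e2, e3, e4]
  nlinarith

lemma minimaxRisk_lower (n N : ℕ) (hn : n ≤ N) (hN : 0 < N) (A ε h m q s u : ℝ) (hA : 0 ≤ A)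
    (hε : 0 ≤ ε) (hq0 : 0 ≤ q) (hq : (n : ℝ) ^ 2 / N ≤ q)
    (hm : A ^ 2 * m ≤ 1) (hmh : m ≤ h) (h0 : 0 ≤ h) (hs : 0 ≤ s) (hu : 0 ≤ u)
    (hqa : 2 * q * A ^ 2 ≤ 1) (b V : ℝ)
    (hb : 4 ^ n * rexp (-(ε ^ 2 * A ^ 2 * h ^ 2 / 2)) ≤ b)
    (hV : rexp (4 * q ^ 2 * A ^ 2) + 2 * (rexp (-(s * m)) * rexp (q * rexp (A ^ 2 * h + s)))
        + rexp (-(u * (2 * h))) * rexp (q * rexp (A ^ 2 * (1 / 2 + ε) * n / 2 + u)) ^ 2 ≤ 1 + V) :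
    1 - minimaxRisk n N A ≤ b + √(V + 2 * b) := by
  set I : Finset (Finset (Fin N) × Finset (Fin N)) := fam n N ×ˢ fam n N with hI
  have hcard : I.card = (fam n N).card ^ 2 := by rw [hI, Finset.card_product, sq]
  have hIpos : (0 : ℝ) < I.card := by
    rw [hcard, card_fam]
    have := Nat.choose_pos hn
    positivity
  set L : Finset (Fin N) × Finset (Fin N) → (Fin N → Fin N → ℝ) → ℝ :=
    fun p => LR (A • indm p.1 p.2) with hL
  set Γ : Finset (Fin N) × Finset (Fin N) → Set (Fin N → Fin N → ℝ) :=
    fun p => trunc A ε h p.1 p.2 with hΓ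
  have key : ∀ T : Set (Fin N → Fin N → ℝ), MeasurableSet T →
      ∑ p ∈ I, ∫ x in T, L p x ∂(PTheta N 0)
        ≤ I.card * ((PTheta N 0).real T + b + √(V + 2 * b)) := by
    intro T hT
    refine second_moment (PTheta N 0) I L Γ b V (fun p x => (Real.exp_pos _).le)
      (fun p => integrable_exp_ipm' N _) (fun p => integral_exp_ipm' N _)
      (fun p => measurableSet_trunc _ _ _ _ _)
      (fun p p' => integrable_trunc_mul _ _ (measurableSet_trunc _ _ _ _ _)
        (measurableSet_trunc _ _ _ _ _)) ?_ ?_ T hT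
    · intro p hp
      simp only [hI, Finset.mem_product, mem_fam] at hp
      exact (trunc_compl_bound A ε h p.1 p.2 h0 (by positivity) hp.1 hp.2).trans hb
    · have hin : ∀ p ∈ I, ∑ p' ∈ I, ∫ x, (Γ p).indicator (L p) x * (Γ p').indicator (L p') x
          ∂(PTheta N 0) ≤ ((fam n N).card : ℝ) ^ 2 * (1 + V) := by
        intro p hp
        simp only [hI, Finset.mem_product, mem_fam] at hp
        rw [hI, Finset.sum_product]
        refine (overlap_bound n N hn hN p.1 p.2 hp.1 hp.2 q (A ^ 2) m h s (A ^ 2 * (1 / 2 + ε)) u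
          hq0 hq (sq_nonneg A) hm hmh h0 hs (by positivity) hu hqa _ ?_ ?_).trans ?_
        · intro R' _ C' _
          exact cross_bound1 A p.1 p.2 R' C' (measurableSet_trunc _ _ _ _ _)
            (measurableSet_trunc _ _ _ _ _)
        · intro R' _ C' _ k1 k2
          exact cross_bound2 A ε h hA p.1 p.2 R' C' k1 k2
        · gcongr
      refine (Finset.sum_le_card_nsmul _ _ _ hin).trans ?_
      rw [nsmul_eq_mul, hcard]
      push_cast
      apply le_of_eq; ring
  have hmain : 1 - (b + √(V + 2 * b)) ≤ minimaxRisk n N A := by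
    unfold _root_.minimaxRisk
    haveI : Nonempty {T : Set (Fin N → Fin N → ℝ) // MeasurableSet T} := ⟨⟨∅, MeasurableSet.empty⟩⟩
    refine le_ciInf fun ⟨T, hT⟩ => ?_
    unfold testRisk
    simp only
    set M := ⨆ θ : ThetaSet A n N, (PTheta N θ.1 Tᶜ).toReal with hM
    have hbdd : BddAbove (Set.range fun θ : ThetaSet A n N => (PTheta N θ.1 Tᶜ).toReal) :=
      ⟨1, by rintro _ ⟨θ, rfl⟩; exact measureReal_le_one⟩
    have hle : ∀ p ∈ I, 1 - M ≤ ∫ x in T, L p x ∂(PTheta N 0) := by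
      intro p hp
      simp only [hI, Finset.mem_product, mem_fam] at hp
      have hmem : A • indm p.1 p.2 ∈ ThetaSet A n N := by
        refine ⟨p.1, p.2, hp.1, hp.2, ?_, ?_⟩
        · intro i j hi hj; simp [indm, hi, hj]
        · intro i j hij
          simp only [indm, Pi.smul_apply, smul_eq_mul]
          split_ifs <;> simp_all
      have h1 := le_ciSup hbdd ⟨_, hmem⟩
      simp only at h1
      rw [← hM] at h1
      have h2 := PTheta_apply N (A • indm p.1 p.2) hT
      have h3 : (PTheta N (A • indm p.1 p.2)).real Tᶜ = 1 - (PTheta N (A • indm p.1 p.2)).real T :=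
        probReal_compl_eq_one_sub hT
      simp only [Measure.real] at h3
      rw [hL]; simp only
      rw [← h2]
      linarith
    have h4 := (Finset.card_nsmul_le_sum _ _ _ hle).trans (key T hT)
    rw [nsmul_eq_mul] at h4
    have h5 := le_of_mul_le_mul_left h4 hIpos
    simp only [Measure.real] at h5
    linarith
  linarith

/-! ### Asymptotics -/

lemma ev_log_le (r c : ℝ) (hr : 0 < r) (hc : 0 < c) :
    ∀ᶠ x : ℝ in atTop, Real.log x ≤ c * x ^ r := by
  filter_upwards [(isLittleO_log_rpow_atTop hr).bound hc, eventually_gt_atTop 0] with x hx h0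
  rw [Real.norm_of_nonneg (Real.rpow_nonneg h0.le r)] at hx
  exact (Real.le_norm_self _).trans hx

lemma ev_rpow_log_le (r c : ℝ) (hr : 0 < r) (hc : 0 < c) :
    ∀ᶠ x : ℝ in atTop, x ^ (-r) * Real.log x ≤ c := by
  filter_upwards [ev_log_le r c hr hc, eventually_gt_atTop 0] with x hx h0
  have h1 : 0 < x ^ r := Real.rpow_pos_of_pos h0 r
  rw [Real.rpow_neg h0.le, inv_mul_le_iff₀ h1]
  linarith

lemma ev_rpow_le (a c : ℝ) (ha : 0 < a) (hc : 0 < c) :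
    ∀ᶠ x : ℝ in atTop, x ^ (1 - a) ≤ c * x := by
  filter_upwards [(tendsto_rpow_neg_atTop ha).eventually_le_const hc, eventually_gt_atTop 0]
    with x hx h0
  rw [show (1 - a) = -a + 1 by ring, Real.rpow_add_one h0.ne']
  gcongr

lemma ev_exp_le (c p κ : ℝ) (hc : 0 < c) (hκ : 0 < κ) :
    ∀ᶠ x : ℝ in atTop, rexp (-c * x) ≤ κ * x ^ p * Real.log x := by
  filter_upwards [(isLittleO_exp_neg_mul_rpow_atTop hc p).bound hκ, eventually_gt_atTop 0,
    Real.tendsto_log_atTop.eventually_ge_atTop 1] with x hx h0 hl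
  have h1 : 0 < x ^ p := Real.rpow_pos_of_pos h0 p
  rw [Real.norm_of_nonneg h1.le, Real.norm_of_nonneg (Real.exp_pos _).le] at hx
  refine hx.trans (le_mul_of_one_le_right (by positivity) hl)

set_option maxHeartbeats 1600000 in
lemma risk_bounds (α δ : ℝ) (hα : 1 / 2 < α) (hδ : -1 < δ) (hδ0 : δ < 0) :
    ∀ᶠ n : ℕ in atTop,
      0 < √((1 + δ) * α) * (n : ℝ) ^ (1 / 2 - α) * √(Real.log n) ∧
      2 * gaussianPDFReal 0 1 1 * (√((1 + δ) * α) * (n : ℝ) ^ (1 / 2 - α) * √(Real.log n))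
        ≤ 1 - minimaxRisk n ⌊(n : ℝ) ^ (1 + α)⌋₊ (√(4 * (1 + δ) * α * Real.log n / n)) ∧
      1 - minimaxRisk n ⌊(n : ℝ) ^ (1 + α)⌋₊ (√(4 * (1 + δ) * α * Real.log n / n))
        ≤ 13 * (√((1 + δ) * α) * (n : ℝ) ^ (1 / 2 - α) * √(Real.log n)) := by
  obtain ⟨κ, hκdef⟩ : ∃ κ, κ = (1 + δ) * α := ⟨_, rfl⟩
  have hκ : 0 < κ := by rw [hκdef]; exact mul_pos (by linarith) (by linarith)
  have hκα : κ ≤ α := by rw [hκdef]; nlinarith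
  have hd2 : 0 < δ ^ 2 := by nlinarith
  have hα0 : 0 < α := by linarith
  have e1 := ev_rpow_log_le α (1 / (16 * κ)) hα0 (by positivity)
  have e2 := ev_rpow_log_le (2 * α - 1) (1 / (64 * κ)) (by linarith) (by positivity)
  have e3 := ev_rpow_le (α / 4) (1 / 64) (by positivity) (by norm_num)
  have e4 := ev_rpow_le (δ ^ 2 * α / 2) (1 / 4) (by positivity) (by norm_num)
  have e5 := ev_exp_le (1 / 32) (1 - 2 * α) κ (by norm_num) hκ
  have e6 := Real.tendsto_log_atTop.eventually_ge_atTop (1 + 2 / κ)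
  have e7 := Real.tendsto_log_atTop.eventually_ge_atTop (16 / (δ ^ 2 * α))
  have e8 := Real.tendsto_log_atTop.eventually_ge_atTop (128 * (1 + Real.log 4) / (δ ^ 2 * κ))
  have eall := ((((((((e1.and e2).and e3).and e4).and e5).and e6).and e7).and e8).and
    (eventually_ge_atTop (2 : ℝ)))
  filter_upwards [tendsto_natCast_atTop_atTop.eventually eall] with n hn
  obtain ⟨⟨⟨⟨⟨⟨⟨⟨f1, f2⟩, f3⟩, f4⟩, f5⟩, f6⟩, f7⟩, f8⟩, f9⟩ := hn
  rw [← hκdef]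
  rw [show 4 * (1 + δ) * α * Real.log n / n = 4 * κ * Real.log n / n by rw [hκdef]; ring]
  obtain ⟨x, hx⟩ : ∃ x : ℝ, x = (n : ℝ) := ⟨_, rfl⟩
  rw [← hx] at f1 f2 f3 f4 f5 f6 f7 f8 f9 ⊢
  obtain ⟨l, hl⟩ : ∃ l : ℝ, l = Real.log x := ⟨_, rfl⟩
  rw [← hl] at f1 f2 f5 f6 f7 f8 ⊢
  have hx0 : 0 < x := by linarith
  have hlx : ∀ y, rexp (y * l) = x ^ y := by
    intro y; rw [Real.rpow_def_of_pos hx0, hl, mul_comm]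
  have h2κ : 0 < 2 / κ := by positivity
  have hl0 : 0 < l := by linarith
  set A := √(4 * κ * l / x) with hAdef
  have hA0 : 0 ≤ A := Real.sqrt_nonneg _
  have hA2 : A ^ 2 = 4 * κ * l / x := Real.sq_sqrt (by positivity)
  set Q := √κ * x ^ (1 / 2 - α) * √l with hQ
  have hxp : 0 < x ^ (1 / 2 - α) := Real.rpow_pos_of_pos hx0 _
  have hQ0 : 0 < Q := by
    have := Real.sqrt_pos.2 hκ
    have := Real.sqrt_pos.2 hl0
    positivity
  have hQ2 : Q ^ 2 = κ * x ^ (1 - 2 * α) * l := by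
    rw [hQ, mul_pow, mul_pow, Real.sq_sqrt hκ.le, Real.sq_sqrt hl0.le, ← Real.rpow_natCast,
      ← Real.rpow_mul hx0.le]
    congr 3; push_cast; ring
  have hQsmall : 64 * Q ^ 2 ≤ 1 := by
    rw [hQ2]
    rw [show -(2 * α - 1) = 1 - 2 * α by ring, le_div_iff₀ (by positivity)] at f2
    linarith
  have hQ8 : 8 * Q ≤ 1 := by nlinarith
  -- N
  set N := ⌊x ^ (1 + α)⌋₊ with hN
  have hxbig : x ≤ x ^ (1 + α) := by
    conv_lhs => rw [← Real.rpow_one x]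
    exact Real.rpow_le_rpow_of_exponent_le (by linarith) (by linarith)
  have hNle : (N : ℝ) ≤ x ^ (1 + α) := Nat.floor_le (by positivity)
  have hNge : x ^ (1 + α) / 2 ≤ N := by
    have := Nat.lt_floor_add_one (x ^ (1 + α))
    rw [← hN] at this
    linarith
  have hnN : n ≤ N := Nat.le_floor (by rw [← hx]; exact hxbig)
  have hNpos' : (0 : ℝ) < N := lt_of_lt_of_le (by positivity) hNge
  have hNpos : 0 < N := by exact_mod_cast hNpos'
  refine ⟨hQ0, ?_, ?_⟩
  · -- lower bound
    have hμ : 2 * Q ≤ (n : ℝ) ^ 2 * A / N := by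
      rw [← hx, le_div_iff₀ hNpos']
      have hAe : A = 2 * √κ * √l * x ^ (-(1 / 2) : ℝ) := by
        rw [hAdef, Real.sqrt_eq_iff_eq_sq (by positivity) (by positivity)]
        have hh : (x ^ (-(1 / 2) : ℝ)) ^ 2 = x⁻¹ := by
          rw [← Real.rpow_natCast, ← Real.rpow_mul hx0.le,
            show (-(1 / 2) * ((2 : ℕ) : ℝ) : ℝ) = -1 by norm_num, Real.rpow_neg_one]
        rw [mul_pow, mul_pow, mul_pow, Real.sq_sqrt hκ.le, Real.sq_sqrt hl0.le, hh]
        ring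
      calc 2 * Q * N ≤ 2 * Q * x ^ (1 + α) := by gcongr
        _ = 2 * √κ * √l * (x ^ (1 / 2 - α) * x ^ (1 + α)) := by rw [hQ]; ring
        _ = 2 * √κ * √l * (x ^ 2 * x ^ (-(1 / 2) : ℝ)) := by
            rw [← Real.rpow_add hx0, ← Real.rpow_natCast, ← Real.rpow_add hx0]
            congr 2; push_cast; ring
        _ = x ^ 2 * A := by rw [hAe]; ring
    have := minimaxRisk_upper n N A (2 * Q) hNpos hA0 (by positivity) (by linarith) hμ
    linarith
  · -- upper bound
    have hb : 4 ^ n * rexp (-((-δ / 2) ^ 2 * A ^ 2 * (x / 8) ^ 2 / 2)) ≤ Q ^ 2 := by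
      have h4 : (4 : ℝ) ^ n = rexp (x * Real.log 4) := by
        rw [mul_comm, ← Real.rpow_def_of_pos (by norm_num), hx, Real.rpow_natCast]
      rw [h4, ← Real.exp_add, hA2, hQ2]
      refine le_trans (Real.exp_le_exp.2 ?_) f5
      have e : (-δ / 2) ^ 2 * (4 * κ * l / x) * (x / 8) ^ 2 / 2 = x * (l * (δ ^ 2 * κ) / 128) := by
        field_simp; ring
      rw [e]
      rw [div_le_iff₀ (by positivity)] at f8
      have : 1 + Real.log 4 ≤ l * (δ ^ 2 * κ) / 128 := by linarith
      have := mul_le_mul_of_nonneg_left this hx0.le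
      linarith
    have hq : (n : ℝ) ^ 2 / N ≤ 2 * x ^ (1 - α) := by
      rw [← hx, div_le_iff₀ hNpos']
      calc x ^ 2 = 2 * x ^ (1 - α) * (x ^ (1 + α) / 2) := by
            have : x ^ (1 - α) * x ^ (1 + α) = x ^ 2 := by
              rw [← Real.rpow_add hx0, ← Real.rpow_natCast]; congr 1; push_cast; ring
            linarith
        _ ≤ _ := by gcongr
    have hqa : 2 * (2 * x ^ (1 - α)) * A ^ 2 ≤ 1 := by
      rw [hA2, show (1 - α) = -α + 1 by ring, Real.rpow_add_one hx0.ne']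
      have e : 2 * (2 * (x ^ (-α) * x)) * (4 * κ * l / x) = 16 * κ * (x ^ (-α) * l) := by
        field_simp; ring
      rw [e]
      rw [le_div_iff₀ (by positivity)] at f1
      linarith
    have hmain : rexp (4 * (2 * x ^ (1 - α)) ^ 2 * A ^ 2) ≤ 1 + 128 * Q ^ 2 := by
      have e : 4 * (2 * x ^ (1 - α)) ^ 2 * A ^ 2 = 64 * Q ^ 2 := by
        rw [hA2, hQ2]
        have : (x ^ (1 - α)) ^ 2 = x ^ (1 - 2 * α) * x := by
          rw [← Real.rpow_natCast, ← Real.rpow_mul hx0.le, ← Real.rpow_add_one hx0.ne']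
          congr 1; push_cast; ring
        rw [mul_pow, this]
        field_simp; ring
      rw [e]
      have hnn : 0 ≤ 64 * Q ^ 2 := by positivity
      have := Real.abs_exp_sub_one_le (x := 64 * Q ^ 2) (by rw [abs_of_nonneg hnn]; exact hQsmall)
      rw [abs_of_nonneg hnn] at this
      linarith [(le_abs_self _).trans this]
    have hB : rexp (-(κ * l / 4 * (x / (4 * κ * l)))) *
        rexp (2 * x ^ (1 - α) * rexp (A ^ 2 * (x / 8) + κ * l / 4)) ≤ Q ^ 2 := by
      rw [← Real.exp_add, hQ2]
      refine le_trans (Real.exp_le_exp.2 ?_) f5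
      have e : κ * l / 4 * (x / (4 * κ * l)) = x / 16 := by field_simp; ring
      have e' : A ^ 2 * (x / 8) + κ * l / 4 = (3 * κ / 4) * l := by rw [hA2]; field_simp; ring
      rw [e, e', hlx]
      have : x ^ (3 * κ / 4) ≤ x ^ (3 * α / 4) :=
        Real.rpow_le_rpow_of_exponent_le (by linarith) (by linarith)
      have h2 : 2 * x ^ (1 - α) * x ^ (3 * κ / 4) ≤ 2 * x ^ (1 - α / 4) := by
        calc _ ≤ 2 * x ^ (1 - α) * x ^ (3 * α / 4) := by gcongr
          _ = _ := by
            rw [mul_assoc, ← Real.rpow_add hx0]; congr 2; ring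
      linarith
    have hD : rexp (-(δ ^ 2 * α * l / 2 * (2 * (x / 8)))) *
        rexp (2 * x ^ (1 - α) * rexp (A ^ 2 * (1 / 2 + -δ / 2) * n / 2 + δ ^ 2 * α * l / 2)) ^ 2
        ≤ Q ^ 2 := by
      rw [← Real.exp_nat_mul, ← Real.exp_add, hQ2, ← hx]
      refine le_trans (Real.exp_le_exp.2 ?_) f5
      have e' : A ^ 2 * (1 / 2 + -δ / 2) * x / 2 + δ ^ 2 * α * l / 2
          = (α - δ ^ 2 * α / 2) * l := by
        rw [hA2, hκdef]; field_simp; ring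
      rw [e', hlx]
      have h2 : 2 * x ^ (1 - α) * x ^ (α - δ ^ 2 * α / 2) = 2 * x ^ (1 - δ ^ 2 * α / 2) := by
        rw [mul_assoc, ← Real.rpow_add hx0]; congr 2; ring
      rw [h2]
      rw [div_le_iff₀ (by positivity)] at f7
      have := mul_le_mul_of_nonneg_left f7 hx0.le
      push_cast
      linarith
    have h3 : 2 ≤ κ * l := by
      have : 2 / κ ≤ l := by linarith
      rw [div_le_iff₀ hκ] at this
      linarith
    have hmh : x / (4 * κ * l) ≤ x / 8 :=
      div_le_div_of_nonneg_left hx0.le (by norm_num) (by linarith)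
    have hm : A ^ 2 * (x / (4 * κ * l)) ≤ 1 := by
      rw [hA2]; apply le_of_eq; field_simp
    have g1 : 0 ≤ 2 * x ^ (1 - α) := by positivity
    have g2 : 0 ≤ κ * l / 4 := by positivity
    have g3 : 0 ≤ δ ^ 2 * α * l / 2 := by positivity
    have g4 : 0 ≤ -δ / 2 := by linarith
    have g5 : 0 ≤ x / 8 := by linarith
    have hfin := minimaxRisk_lower n N hnN hNpos A (-δ / 2) (x / 8) (x / (4 * κ * l))
      (2 * x ^ (1 - α)) (κ * l / 4) (δ ^ 2 * α * l / 2) hA0 g4 g1 hq hm hmh g5 g2 g3 hqa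
      (Q ^ 2) (131 * Q ^ 2) hb (by linarith only [hmain, hB, hD])
    have h5 : √(131 * Q ^ 2 + 2 * Q ^ 2) ≤ 12 * Q := by
      apply Real.sqrt_le_iff.2
      constructor
      · linarith
      · have := sq_nonneg Q
        linarith
    have h6 : Q ^ 2 ≤ Q := by
      rw [sq]
      exact mul_le_of_le_one_left hQ0.le (by linarith)
    linarith only [hfin, h5, h6]

theorem sparse_below_boundary :
    (∀ α δ : ℝ, 1 / 2 < α → -1 < δ → δ < 0 →
      Tendsto (fun n : ℕ =>
          Real.log (1 - minimaxRisk n ⌊(n : ℝ) ^ (1 + α)⌋₊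
              (Real.sqrt (4 * (1 + δ) * α * Real.log n / n))) / Real.log n)
        atTop (𝓝 (1 / 2 - α))) ∧
    ∃ c C : ℝ, 0 < c ∧ 0 < C ∧
      ∀ α δ : ℝ, 1 / 2 < α → -1 < δ → δ < 0 →
        ∃ n₀ : ℕ, ∀ n : ℕ, n₀ ≤ n →
          c ≤ (1 - minimaxRisk n ⌊(n : ℝ) ^ (1 + α)⌋₊
                  (Real.sqrt (4 * (1 + δ) * α * Real.log n / n))) /
                (Real.sqrt ((1 + δ) * α) * (n : ℝ) ^ (1 / 2 - α) * Real.sqrt (Real.log n)) ∧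
            (1 - minimaxRisk n ⌊(n : ℝ) ^ (1 + α)⌋₊
                  (Real.sqrt (4 * (1 + δ) * α * Real.log n / n))) /
                (Real.sqrt ((1 + δ) * α) * (n : ℝ) ^ (1 / 2 - α) * Real.sqrt (Real.log n)) ≤ C := by
  have hφ : 0 < 2 * gaussianPDFReal 0 1 1 := by
    have := gaussianPDFReal_pos 0 1 1 one_ne_zero
    positivity
  constructor
  · intro α δ hα hδ hδ0
    have hκ : 0 < (1 + δ) * α := mul_pos (by linarith) (by linarith)
    have hlog : Tendsto (fun n : ℕ => Real.log n) atTop atTop :=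
      Real.tendsto_log_atTop.comp tendsto_natCast_atTop_atTop
    have hll : Tendsto (fun n : ℕ => Real.log (Real.log n) / Real.log n) atTop (𝓝 0) :=
      (Real.isLittleO_log_id_atTop.tendsto_div_nhds_zero).comp hlog
    have hlim : ∀ c : ℝ, Tendsto (fun n : ℕ => (c + Real.log √((1 + δ) * α)) / Real.log n
        + (1 / 2 - α) + 1 / 2 * (Real.log (Real.log n) / Real.log n)) atTop (𝓝 (1 / 2 - α)) := by
      intro c
      have h1 : Tendsto (fun n : ℕ => (c + Real.log √((1 + δ) * α)) / Real.log n) atTop (𝓝 0) :=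
        tendsto_const_nhds.div_atTop hlog
      have := (h1.add_const (1 / 2 - α)).add (hll.const_mul (1 / 2))
      simpa using this
    have hform : ∀ c : ℝ, 0 < c → ∀ n : ℕ, 0 < Real.log n →
        Real.log (c * (√((1 + δ) * α) * (n : ℝ) ^ (1 / 2 - α) * √(Real.log n))) / Real.log n
        = (Real.log c + Real.log √((1 + δ) * α)) / Real.log n
        + (1 / 2 - α) + 1 / 2 * (Real.log (Real.log n) / Real.log n) := by
      intro c hc n hn
      have hn0 : (0 : ℝ) < n := by
        rcases Nat.eq_zero_or_pos n with h | h
        · simp [h] at hn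
        · exact_mod_cast h
      have s1 := Real.sqrt_pos.2 hκ
      have s2 := Real.sqrt_pos.2 hn
      have s3 := Real.rpow_pos_of_pos hn0 (1 / 2 - α)
      rw [Real.log_mul hc.ne' (by positivity), Real.log_mul (by positivity) s2.ne',
        Real.log_mul s1.ne' s3.ne', Real.log_rpow hn0, Real.log_sqrt hn.le]
      field_simp
      ring
    refine tendsto_of_tendsto_of_tendsto_of_le_of_le' (hlim (Real.log (2 * gaussianPDFReal 0 1 1)))
      (hlim (Real.log 13)) ?_ ?_
    · filter_upwards [risk_bounds α δ hα hδ hδ0, hlog.eventually_gt_atTop 0] with n ⟨q0, q1, q2⟩ hl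
      rw [← hform _ hφ n hl]
      gcongr
    · filter_upwards [risk_bounds α δ hα hδ hδ0, hlog.eventually_gt_atTop 0] with n ⟨q0, q1, q2⟩ hl
      rw [← hform 13 (by norm_num) n hl]
      have : 0 < 1 - minimaxRisk n ⌊(n : ℝ) ^ (1 + α)⌋₊
              (Real.sqrt (4 * (1 + δ) * α * Real.log n / n)) := lt_of_lt_of_le (by positivity) q1
      gcongr
  · refine ⟨2 * gaussianPDFReal 0 1 1, 13, hφ, by norm_num, ?_⟩
    intro α δ hα hδ hδ0
    obtain ⟨n₀, h⟩ := eventually_atTop.1 (risk_bounds α δ hα hδ hδ0)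
    refine ⟨n₀, fun n hn => ?_⟩
    obtain ⟨q0, q1, q2⟩ := h n hn
    exact ⟨(le_div_iff₀ q0).2 q1, (div_le_iff₀ q0).2 q2⟩

end
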